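/- arXiv:2207.13365 — 3 statements merged into one kernel-verified Lean document; each statement's English description precedes it below -/
import Mathlib

section
/- Let N ≥ 3 be a natural number and let Γ(N) be the principal congruence subgroup of SL(2,ℤ), i.e. the subgroup of matrices congruent to the identity modulo N. Then the image of Γ(N) under the quotient map SL(2,ℤ) → PSL(2,ℤ) = SL(2,ℤ)/{±I} has finite index in PSL(2,ℤ), and this index equals (1/2)·N³·∏_{p | N} (1 − 1/p²), where the product runs over the prime divisors p of N. -/
/-- The subgroup `{±I}` of `SL(2, ℤ)` (the cyclic subgroup generated by `-I`). -/
def pmOne : Subgroup (Matrix.SpecialLinearGroup (Fin 2) ℤ) := Subgroup.zpowers (-1)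

instance pmOne.normal : pmOne.Normal := by
  have hc : ∀ g : Matrix.SpecialLinearGroup (Fin 2) ℤ, Commute g (-1) := fun g =>
    Subtype.coe_injective (by simp)
  constructor
  intro x hx g
  obtain ⟨k, hk⟩ := Subgroup.mem_zpowers_iff.mp hx
  subst hk
  exact Subgroup.mem_zpowers_iff.mpr
    ⟨k, by rw [((hc g).zpow_right k).eq]; group⟩

/-- `PSL(2, ℤ)`, the quotient of `SL(2, ℤ)` by `{±I}`. -/
abbrev PSL2Z : Type := Matrix.SpecialLinearGroup (Fin 2) ℤ ⧸ pmOne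

/-- The special linear group of degree two is parametrized by unimodular bottom rows together with
a free upper triangular parameter. -/
noncomputable def Matrix.SpecialLinearGroup.equivProdCoprimePairs (R : Type*) [CommRing R] :
    Matrix.SpecialLinearGroup (Fin 2) R ≃ R × {x : R × R // IsCoprime x.1 x.2} where
  toFun g :=
    let h : IsCoprime (g 1 0) (g 1 1) :=
      ⟨-g 0 1, g 0 0, by linear_combination (Matrix.det_fin_two g.1).symm.trans g.2⟩
    (h.choose * g 0 0 + h.choose_spec.choose * g 0 1, ⟨(g 1 0, g 1 1), h⟩)
  invFun y :=
    ⟨!![y.2.2.choose_spec.choose + y.1 * y.2.1.1, -y.2.2.choose + y.1 * y.2.1.2;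
      y.2.1.1, y.2.1.2], by
      rw [Matrix.det_fin_two_of]
      linear_combination y.2.2.choose_spec.choose_spec⟩
  left_inv g := by
    have h : IsCoprime (g 1 0) (g 1 1) :=
      ⟨-g 0 1, g 0 0, by linear_combination (Matrix.det_fin_two g.1).symm.trans g.2⟩
    have hg : g 0 0 * g 1 1 - g 0 1 * g 1 0 = 1 := (Matrix.det_fin_two g.1).symm.trans g.2
    have huv := h.choose_spec.choose_spec
    ext i j
    fin_cases i <;> fin_cases j
    · change h.choose_spec.choose + (h.choose * g 0 0 + h.choose_spec.choose * g 0 1) * g 1 0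
        = g 0 0
      linear_combination g 0 0 * huv - h.choose_spec.choose * hg
    · change -h.choose + (h.choose * g 0 0 + h.choose_spec.choose * g 0 1) * g 1 1 = g 0 1
      linear_combination g 0 1 * huv + h.choose * hg
    · rfl
    · rfl
  right_inv := by
    rintro ⟨x, ⟨⟨c, d⟩, h⟩⟩
    refine Prod.ext ?_ rfl
    change h.choose * (h.choose_spec.choose + x * c) +
      h.choose_spec.choose * (-h.choose + x * d) = x
    linear_combination x * h.choose_spec.choose_spec

/-- A pair of integers that is unimodular modulo `N` is congruent to a coprime pair. -/
theorem Int.exists_isCoprime_of_isCoprime_zmod (N : ℕ) [NeZero N] {c d : ZMod N}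
    (h : IsCoprime c d) :
    ∃ a b : ℤ, (a : ZMod N) = c ∧ (b : ZMod N) = d ∧ IsCoprime a b := by
  let a : ℕ := c.val + N
  have ha0 : a ≠ 0 := by have := NeZero.ne N; omega
  have : NeZero a := ⟨ha0⟩
  have hac : (a : ZMod N) = c := by simp [a]
  let e := a.gcd N
  have hd : IsUnit ((d.val : ℕ) : ZMod e) := by
    have h' := h.map (ZMod.castHom (Nat.gcd_dvd_right a N) (ZMod e))
    rw [← hac, map_natCast, (ZMod.natCast_eq_zero_iff a e).2 (Nat.gcd_dvd_left a N),
      isCoprime_zero_left, ← ZMod.natCast_zmod_val d, map_natCast] at h'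
    exact h'
  obtain ⟨w, hw⟩ := ZMod.unitsMap_surjective (Nat.gcd_dvd_left a N) hd.unit
  have hw' : ((w.val.val : ℤ) : ZMod e) = ((d.val : ℤ) : ZMod e) := by
    have := congrArg Units.val hw
    rw [ZMod.unitsMap_val, IsUnit.unit_spec, ZMod.cast_eq_val] at this
    exact_mod_cast this
  obtain ⟨t, ht⟩ := (ZMod.intCast_eq_intCast_iff_dvd_sub _ _ e).1 hw'.symm
  have hbez : (e : ℤ) = a * Nat.gcdA a N + N * Nat.gcdB a N := Nat.gcd_eq_gcd_ab a N
  refine ⟨a, d.val + N * (Nat.gcdB a N * t), by simpa using hac, by simp, ?_⟩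
  have hcop : IsCoprime (a : ℤ) w.val.val :=
    Nat.isCoprime_iff_coprime.2 (ZMod.val_coe_unit_coprime w).symm
  have : (d.val + N * (Nat.gcdB a N * t) : ℤ) = w.val.val + a * (-(Nat.gcdA a N * t)) := by
    rw [hbez] at ht
    linear_combination -ht
  rw [this]
  exact hcop.add_mul_left_right _

theorem Matrix.SpecialLinearGroup.map_intCast_zmod_surjective (N : ℕ) [NeZero N] :
    Function.Surjective
      (Matrix.SpecialLinearGroup.map (n := Fin 2) (Int.castRingHom (ZMod N))) := by
  intro g
  have hg : g 0 0 * g 1 1 - g 0 1 * g 1 0 = 1 := (Matrix.det_fin_two g.1).symm.trans g.2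
  obtain ⟨c, d, hc, hd, u, v, huv⟩ := Int.exists_isCoprime_of_isCoprime_zmod N
    (c := g 1 0) (d := g 1 1) ⟨-g 0 1, g 0 0, by linear_combination hg⟩
  obtain ⟨x, hx⟩ := ZMod.intCast_surjective ((u : ZMod N) * g 0 0 + (v : ZMod N) * g 0 1)
  have huv' := congrArg (Int.cast : ℤ → ZMod N) huv
  push_cast at huv'
  rw [hc, hd] at huv'
  refine ⟨⟨!![v + x * c, -u + x * d; c, d], ?_⟩, ?_⟩
  · rw [Matrix.det_fin_two_of]
    linear_combination huv
  ext i j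
  fin_cases i <;> fin_cases j
  · change ((v + x * c : ℤ) : ZMod N) = g 0 0
    push_cast
    rw [hx, hc]
    linear_combination g 0 0 * huv' - v * hg
  · change ((-u + x * d : ℤ) : ZMod N) = g 0 1
    push_cast
    rw [hx, hd]
    linear_combination g 0 1 * huv' + u * hg
  · exact hc
  · exact hd

theorem Prod.isCoprime_iff {R S : Type*} [CommSemiring R] [CommSemiring S] {x y : R × S} :
    IsCoprime x y ↔ IsCoprime x.1 y.1 ∧ IsCoprime x.2 y.2 := by
  refine ⟨fun h ↦ ⟨h.map (RingHom.fst R S), h.map (RingHom.snd R S)⟩, ?_⟩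
  rintro ⟨⟨a, b, h⟩, ⟨a', b', h'⟩⟩
  exact ⟨(a, a'), (b, b'), Prod.ext h h'⟩

theorem RingEquiv.isCoprime_map_iff {R S : Type*} [CommSemiring R] [CommSemiring S] (e : R ≃+* S)
    {x y : R} : IsCoprime (e x) (e y) ↔ IsCoprime x y :=
  ⟨fun h ↦ by simpa using h.map (e.symm : S →+* R), fun h ↦ h.map (e : R →+* S)⟩

theorem ZMod.card_coprimePairs_mul {m n : ℕ} (h : m.Coprime n) :
    Nat.card {x : ZMod (m * n) × ZMod (m * n) // IsCoprime x.1 x.2} =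
      Nat.card {x : ZMod m × ZMod m // IsCoprime x.1 x.2} *
        Nat.card {x : ZMod n × ZMod n // IsCoprime x.1 x.2} := by
  let e := ZMod.chineseRemainder h
  rw [← Nat.card_prod]
  refine Nat.card_congr (Equiv.trans (Equiv.subtypeEquiv
    ((e.toEquiv.prodCongr e.toEquiv).trans (Equiv.prodProdProdComm _ _ _ _)) fun x ↦ ?_)
    (Equiv.subtypeProdEquivProd (p := fun x : ZMod m × ZMod m ↦ IsCoprime x.1 x.2)
      (q := fun x : ZMod n × ZMod n ↦ IsCoprime x.1 x.2)))
  exact e.isCoprime_map_iff.symm.trans Prod.isCoprime_iff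

theorem IsLocalRing.isCoprime_iff {R : Type*} [CommRing R] [IsLocalRing R] {x y : R} :
    IsCoprime x y ↔ IsUnit x ∨ IsUnit y := by
  constructor
  · rintro ⟨a, b, h⟩
    exact (IsLocalRing.isUnit_or_isUnit_of_add_one h).imp isUnit_of_mul_isUnit_right
      isUnit_of_mul_isUnit_right
  · rintro (h | h)
    · exact isCoprime_one_left.of_isCoprime_of_dvd_left h.dvd
    · exact isCoprime_one_right.of_isCoprime_of_dvd_right h.dvd

theorem ZMod.card_nonunits_prime_pow {p k : ℕ} (hp : p.Prime) :
    Nat.card {x : ZMod (p ^ (k + 1)) // ¬ IsUnit x} = p ^ k := by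
  have : NeZero (p ^ (k + 1)) := ⟨pow_ne_zero _ hp.ne_zero⟩
  have hu : Nat.card {x : ZMod (p ^ (k + 1)) // IsUnit x} = p ^ k * (p - 1) := by
    rw [← Nat.totient_prime_pow_succ hp, ← ZMod.card_units_eq_totient, ← Nat.card_eq_fintype_card]
    exact Nat.card_congr (Submonoid.unitsTypeEquivIsUnitSubmonoid (M := ZMod _)).symm.toEquiv
  classical
  have h := Nat.card_congr (Equiv.sumCompl fun x : ZMod (p ^ (k + 1)) ↦ IsUnit x)
  rw [Nat.card_sum, hu, Nat.card_zmod, pow_succ] at h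
  have hp1 : p ^ k * p = p ^ k * (p - 1) + p ^ k := by
    rw [← Nat.mul_succ, Nat.succ_eq_add_one, Nat.sub_add_cancel hp.one_le]
  exact Nat.add_left_cancel (h.trans hp1)

theorem ZMod.card_coprimePairs_prime_pow {p k : ℕ} (hp : p.Prime) :
    Nat.card {x : ZMod (p ^ (k + 1)) × ZMod (p ^ (k + 1)) // IsCoprime x.1 x.2} + (p ^ k) ^ 2 =
      (p ^ (k + 1)) ^ 2 := by
  have : NeZero (p ^ (k + 1)) := ⟨pow_ne_zero _ hp.ne_zero⟩
  have : Fact p.Prime := ⟨hp⟩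
  have : Fact (1 < p ^ (k + 1)) := ⟨Nat.one_lt_pow k.succ_ne_zero hp.one_lt⟩
  have : IsLocalRing (ZMod (p ^ (k + 1))) :=
    IsLocalRing.of_surjective' (PadicInt.toZModPow (p := p) (k + 1)) (ZMod.ringHom_surjective _)
  have hc : Nat.card {x : ZMod (p ^ (k + 1)) × ZMod (p ^ (k + 1)) // ¬ IsCoprime x.1 x.2} =
      (p ^ k) ^ 2 := by
    rw [sq, ← ZMod.card_nonunits_prime_pow (k := k) hp, ← Nat.card_prod]
    refine Nat.card_congr ((Equiv.subtypeEquivRight fun x ↦ ?_).trans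
      Equiv.subtypeProdEquivProd)
    rw [IsLocalRing.isCoprime_iff, not_or]
  classical
  rw [← hc, ← Nat.card_sum, Nat.card_congr (Equiv.sumCompl _), Nat.card_prod, Nat.card_zmod, sq]

theorem ZMod.card_coprimePairs {n : ℕ} (hn : n ≠ 0) :
    (Nat.card {x : ZMod n × ZMod n // IsCoprime x.1 x.2} : ℚ) =
      (n : ℚ) ^ 2 * ∏ p ∈ n.primeFactors, (1 - 1 / (p : ℚ) ^ 2) := by
  induction n using Nat.recOnPosPrimePosCoprime with
  | zero => exact absurd rfl hn
  | one =>
    have : Nat.card {x : ZMod 1 × ZMod 1 // IsCoprime x.1 x.2} = 1 :=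
      Nat.card_eq_one_iff_unique.2
        ⟨inferInstance, ⟨⟨0, 0, 0, Subsingleton.elim _ _⟩⟩⟩
    simp [this]
  | prime_pow p k hp hk =>
    obtain ⟨k, rfl⟩ := Nat.exists_eq_succ_of_ne_zero hk.ne'
    have h := congrArg (Nat.cast : ℕ → ℚ) (ZMod.card_coprimePairs_prime_pow (k := k) hp)
    have hp0 : (p : ℚ) ≠ 0 := Nat.cast_ne_zero.2 hp.ne_zero
    rw [Nat.primeFactors_prime_pow k.succ_ne_zero hp, Finset.prod_singleton]
    push_cast at h ⊢
    rw [eq_sub_of_add_eq h]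
    field_simp
    ring
  | coprime a b ha hb hab iha ihb =>
    rw [ZMod.card_coprimePairs_mul hab, Nat.cast_mul, iha (by omega), ihb (by omega),
      hab.primeFactors_mul, Finset.prod_union hab.disjoint_primeFactors]
    push_cast
    ring

theorem CongruenceSubgroup.index_Gamma {N : ℕ} (hN : N ≠ 0) :
    ((CongruenceSubgroup.Gamma N).index : ℚ) =
      (N : ℚ) ^ 3 * ∏ p ∈ N.primeFactors, (1 - 1 / (p : ℚ) ^ 2) := by
  have : NeZero N := ⟨hN⟩
  rw [CongruenceSubgroup.Gamma, Subgroup.index_ker, MonoidHom.range_eq_top.2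
    (Matrix.SpecialLinearGroup.map_intCast_zmod_surjective N), Subgroup.card_top,
    Nat.card_congr (Matrix.SpecialLinearGroup.equivProdCoprimePairs (ZMod N)), Nat.card_prod,
    Nat.card_zmod, Nat.cast_mul, ZMod.card_coprimePairs hN]
  ring

theorem neg_one_notMem_Gamma {N : ℕ} (hN : 3 ≤ N) : -1 ∉ CongruenceSubgroup.Gamma N := by
  intro h
  have h0 := (CongruenceSubgroup.Gamma_mem.1 h).1
  have : ((2 : ℕ) : ZMod N) = 0 := by
    simp at h0
    push_cast
    linear_combination -h0
  have := Nat.le_of_dvd two_pos ((ZMod.natCast_eq_zero_iff 2 N).1 this)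
  omega

theorem relIndex_Gamma_pmOne {N : ℕ} (hN : 3 ≤ N) :
    (CongruenceSubgroup.Gamma N).relIndex pmOne = 2 := by
  have hne : (-1 : Matrix.SpecialLinearGroup (Fin 2) ℤ) ≠ 1 := fun h ↦
    neg_one_notMem_Gamma hN (h.symm ▸ one_mem (CongruenceSubgroup.Gamma N) :)
  have hsq : (-1 : Matrix.SpecialLinearGroup (Fin 2) ℤ) ^ 2 = 1 := by simp
  have hcard : Nat.card pmOne = 2 := by
    rw [pmOne, Nat.card_zpowers, orderOf_eq_prime hsq hne]
  have hinf : CongruenceSubgroup.Gamma N ⊓ pmOne = ⊥ := by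
    rw [eq_bot_iff]
    rintro g ⟨hg, k, rfl⟩
    rcases Int.even_or_odd' k with ⟨m, rfl | rfl⟩
    · simp [zpow_mul, hsq]
    · refine absurd ?_ (neg_one_notMem_Gamma hN)
      simpa [zpow_add, zpow_mul, hsq] using hg
  rw [← Subgroup.inf_relIndex_right, hinf, Subgroup.relIndex_bot_left, hcard]

theorem two_mul_index_map_Gamma {N : ℕ} (hN : 3 ≤ N) :
    2 * (Subgroup.map (QuotientGroup.mk' pmOne) (CongruenceSubgroup.Gamma N)).index =
      (CongruenceSubgroup.Gamma N).index := by
  have := CongruenceSubgroup.Gamma_normal N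
  rw [Subgroup.index_map, MonoidHom.range_eq_top.2 (QuotientGroup.mk'_surjective _),
    Subgroup.index_top, mul_one, QuotientGroup.ker_mk', ← Subgroup.relIndex_mul_index (le_sup_left :
      CongruenceSubgroup.Gamma N ≤ CongruenceSubgroup.Gamma N ⊔ pmOne), sup_comm,
    Subgroup.relIndex_sup_right, relIndex_Gamma_pmOne hN]

/-- For `N ≥ 3`, the image of the principal congruence subgroup `Γ(N)` under the quotient map
`SL(2, ℤ) → PSL(2, ℤ) = SL(2, ℤ)/{±I}` has finite index, equal to
`(1/2) · N³ · ∏_{p ∣ N prime} (1 - 1/p²)`. -/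
theorem index_image_Gamma_in_PSL (N : ℕ) (hN : 3 ≤ N) :
    (Subgroup.map (QuotientGroup.mk' pmOne) (CongruenceSubgroup.Gamma N)).index ≠ 0 ∧
    ((Subgroup.map (QuotientGroup.mk' pmOne) (CongruenceSubgroup.Gamma N)).index : ℚ) =
      (1 / 2 : ℚ) * (N : ℚ) ^ 3 *
        ∏ p ∈ N.primeFactors, (1 - 1 / (p : ℚ) ^ 2) := by
  have h := two_mul_index_map_Gamma hN
  have : NeZero N := ⟨by omega⟩
  constructor
  · have : (CongruenceSubgroup.Gamma N).index ≠ 0 := Subgroup.FiniteIndex.index_ne_zero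
    omega
  · have h' := congrArg (Nat.cast : ℕ → ℚ) h
    rw [CongruenceSubgroup.index_Gamma (by omega)] at h'
    push_cast at h'
    linear_combination h' / 2
end

section
/- Fix μ ≥ 1. Call a pair (σ_S, σ_R) of permutations of Fin μ legitimate if σ_S² = 1, σ_R³ = 1, and the subgroup of Perm(Fin μ) generated by σ_S and σ_R acts transitively on Fin μ. Call two legitimate pairs (σ_S, σ_R) and (σ_S', σ_R') equivalent modulo 1 if there exists σ ∈ Perm(Fin μ) with σ(0) = 0, σ⁻¹σ_S'σ = σ_S and σ⁻¹σ_R'σ = σ_R. Then there is a bijection between the set of subgroups of PSL(2,ℤ) of index μ and the set of equivalence classes modulo 1 of legitimate pairs of permutations of Fin μ. -/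
/-- A pair `(σ_S, σ_R)` of permutations of `Fin μ` is *legitimate* if `σ_S² = 1`, `σ_R³ = 1`,
and the subgroup generated by `σ_S` and `σ_R` acts transitively on `Fin μ`. -/
def IsLegitimate {μ : ℕ} (p : Equiv.Perm (Fin μ) × Equiv.Perm (Fin μ)) : Prop :=
  p.1 ^ 2 = 1 ∧ p.2 ^ 3 = 1 ∧
    ∀ i j : Fin μ, ∃ g ∈ Subgroup.closure {p.1, p.2}, g i = j

/-- The type of legitimate pairs of permutations of `Fin μ`. -/
def LegitimatePair (μ : ℕ) : Type :=
  {p : Equiv.Perm (Fin μ) × Equiv.Perm (Fin μ) // IsLegitimate p}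

/-- Two legitimate pairs `(σ_S, σ_R)` and `(σ_S', σ_R')` are *equivalent modulo 1* if there is a
permutation `σ` fixing `0` with `σ⁻¹σ_S'σ = σ_S` and `σ⁻¹σ_R'σ = σ_R`. -/
def EquivMod1 {μ : ℕ} (p q : LegitimatePair μ) : Prop :=
  ∃ σ : Equiv.Perm (Fin μ), (∀ h : 0 < μ, σ ⟨0, h⟩ = ⟨0, h⟩) ∧
    σ⁻¹ * q.1.1 * σ = p.1.1 ∧ σ⁻¹ * q.1.2 * σ = p.1.2

open MatrixGroups

/-- The homomorphism from the cyclic group of order `n` determined by an element `g` with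
`g ^ n = 1`. -/
def zmodPowHom {G : Type*} [Group G] (n : ℕ) (g : G) (h : g ^ n = 1) :
    Multiplicative (ZMod n) →* G :=
  AddMonoidHom.toMultiplicativeLeft (ZMod.lift n ⟨zmultiplesHom (Additive G) (Additive.ofMul g), by
    simpa using congrArg Additive.ofMul h⟩)

lemma zmodPowHom_ofAdd_natCast {G : Type*} [Group G] (n : ℕ) (g : G) (h : g ^ n = 1) (k : ℕ) :
    zmodPowHom n g h (Multiplicative.ofAdd (k : ZMod n)) = g ^ k := by
  have := ZMod.lift_coe n (A := Additive G) ⟨zmultiplesHom (Additive G) (Additive.ofMul g), by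
    simpa using congrArg Additive.ofMul h⟩ (k : ℤ)
  simp only [Int.cast_natCast] at this
  simp [zmodPowHom, this]

lemma mem_pmOne {g : SL(2, ℤ)} : g ∈ pmOne ↔ g = 1 ∨ g = -1 := by
  constructor
  · intro h
    obtain ⟨k, rfl⟩ := Subgroup.mem_zpowers_iff.mp h
    rcases Int.even_or_odd k with hk | hk
    · exact Or.inl (by simp [hk.neg_one_zpow])
    · exact Or.inr (by simp [hk.neg_one_zpow])
  · rintro (rfl | rfl)
    · exact one_mem _
    · exact Subgroup.mem_zpowers _

namespace PSL2Z

/-- The class of `S` in `PSL(2, ℤ)`, of order two. -/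
def S : PSL2Z := QuotientGroup.mk ModularGroup.S

/-- The class of `ST` in `PSL(2, ℤ)`, of order three. -/
def R : PSL2Z := QuotientGroup.mk (ModularGroup.S * ModularGroup.T)

lemma S_sq : S ^ 2 = 1 :=
  (QuotientGroup.eq_one_iff (N := pmOne) (ModularGroup.S ^ 2)).mpr
    (mem_pmOne.mpr (Or.inr (by decide)))

lemma R_cube : R ^ 3 = 1 :=
  (QuotientGroup.eq_one_iff (N := pmOne) ((ModularGroup.S * ModularGroup.T) ^ 3)).mpr
    (mem_pmOne.mpr (Or.inr (by decide)))

lemma closure_S_R : Subgroup.closure {S, R} = ⊤ := by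
  have h : Subgroup.closure {ModularGroup.S, ModularGroup.S * ModularGroup.T} = ⊤ := by
    rw [eq_top_iff, ← SpecialLinearGroup.SL2Z_generators, Subgroup.closure_le]
    have hS : ModularGroup.S ∈
        Subgroup.closure {ModularGroup.S, ModularGroup.S * ModularGroup.T} :=
      Subgroup.subset_closure (by simp)
    rintro x (rfl | rfl)
    · exact hS
    · exact (Subgroup.mul_mem_cancel_left _ hS).mp (Subgroup.subset_closure (by simp))
  have hmap := congrArg (Subgroup.map (QuotientGroup.mk' pmOne)) h
  rw [MonoidHom.map_closure, Set.image_pair,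
    Subgroup.map_top_of_surjective _ (QuotientGroup.mk'_surjective _)] at hmap
  exact hmap

/-- The product of the entries of the first column. -/
def colProd : PSL2Z → ℤ :=
  Quotient.lift (fun g : SL(2, ℤ) => g 0 0 * g 1 0) (by
    intro a b hab
    obtain h | h := mem_pmOne.mp (QuotientGroup.leftRel_apply.mp hab)
    · rw [inv_mul_eq_one.mp h]
    · rw [inv_mul_eq_iff_eq_mul.mp h]
      simp)

lemma colProd_mk (g : SL(2, ℤ)) : colProd (QuotientGroup.mk g) = g 0 0 * g 1 0 := rfl

lemma colProd_S_mul {x : PSL2Z} (hx : colProd x < 0) : 0 < colProd (S * x) := by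
  induction x using QuotientGroup.induction_on with | H g => ?_
  rw [S, ← QuotientGroup.mk_mul]
  rw [colProd_mk] at hx ⊢
  simp [Matrix.mul_apply, Fin.sum_univ_two]
  nlinarith

lemma colProd_R_mul {x : PSL2Z} (hx : 0 < colProd x) : colProd (R * x) < 0 := by
  induction x using QuotientGroup.induction_on with | H g => ?_
  rw [R, ← QuotientGroup.mk_mul]
  rw [colProd_mk] at hx ⊢
  simp [Matrix.mul_apply, Fin.sum_univ_two]
  nlinarith [sq_nonneg (g 1 0)]

lemma colProd_R_sq_mul {x : PSL2Z} (hx : 0 < colProd x) : colProd (R ^ 2 * x) < 0 := by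
  induction x using QuotientGroup.induction_on with | H g => ?_
  rw [R, ← QuotientGroup.mk_pow, ← QuotientGroup.mk_mul]
  rw [colProd_mk] at hx ⊢
  simp [pow_two, Matrix.mul_apply, Fin.sum_univ_two]
  nlinarith [sq_nonneg (g 0 0)]

/-- The generators `S` and `R` as a family. -/
def gen : Fin 2 → PSL2Z := ![S, R]

lemma gen_pow (i : Fin 2) : gen i ^ (i.val + 2) = 1 := by
  fin_cases i
  · exact S_sq
  · exact R_cube

/-- The canonical homomorphism `ℤ/2 * ℤ/3 → PSL(2, ℤ)`. -/
def ofCoprod : Monoid.CoprodI (fun i : Fin 2 => Multiplicative (ZMod (i.val + 2))) →* PSL2Z :=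
  Monoid.CoprodI.lift fun i => zmodPowHom _ (gen i) (gen_pow i)

lemma ofCoprod_of_ofAdd_one (i : Fin 2) :
    ofCoprod (Monoid.CoprodI.of (i := i) (Multiplicative.ofAdd 1)) = gen i := by
  simpa [ofCoprod] using zmodPowHom_ofAdd_natCast _ (gen i) (gen_pow i) 1

open scoped Pointwise in
lemma ofCoprod_injective : Function.Injective ofCoprod := by
  refine Monoid.CoprodI.lift_injective_of_ping_pong _ (Or.inr ⟨1, ?_⟩) (α := PSL2Z)
    ![{x | 0 < colProd x}, {x | colProd x < 0}] ?_ ?_ ?_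
  · change 3 ≤ Cardinal.mk (ZMod 3)
    simp
  · have h : 0 < colProd (QuotientGroup.mk (ModularGroup.T * ModularGroup.S)) := by
      rw [colProd_mk]; decide
    intro i
    fin_cases i
    · exact ⟨_, h⟩
    · exact ⟨_, colProd_R_mul h⟩
  · have h : Disjoint {x | 0 < colProd x} {x | colProd x < 0} :=
      Set.disjoint_left.mpr fun x (hx : 0 < colProd x) (hx' : colProd x < 0) => lt_asymm hx hx'
    intro i j hij
    fin_cases i <;> fin_cases j
    · exact absurd rfl hij
    · exact h
    · exact h.symm
    · exact absurd rfl hij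
  · intro i j hij h hh
    obtain ⟨k, hk, rfl⟩ : ∃ k : ℕ, k < i.val + 2 ∧
        Multiplicative.ofAdd (k : ZMod (i.val + 2)) = h :=
      ⟨ZMod.val h.toAdd, ZMod.val_lt h.toAdd, by simp⟩
    rw [zmodPowHom_ofAdd_natCast]
    have hk0 : k ≠ 0 := by
      rintro rfl
      simp at hh
    rintro _ ⟨x, hx, rfl⟩
    fin_cases i <;> fin_cases j
    · exact absurd rfl hij
    · obtain rfl : k = 1 := by simp at hk; omega
      simpa [gen] using colProd_S_mul hx
    · obtain rfl | rfl : k = 1 ∨ k = 2 := by simp at hk; omega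
      · simpa [gen] using colProd_R_mul hx
      · exact colProd_R_sq_mul hx
    · exact absurd rfl hij

lemma ofCoprod_surjective : Function.Surjective ofCoprod := by
  rw [← MonoidHom.range_eq_top, eq_top_iff, ← closure_S_R, Subgroup.closure_le]
  rintro x (rfl | rfl)
  · exact ⟨_, ofCoprod_of_ofAdd_one 0⟩
  · exact ⟨_, ofCoprod_of_ofAdd_one 1⟩

/-- `PSL(2, ℤ)` is the free product of `⟨S⟩` of order two and `⟨R⟩` of order three. -/
theorem exists_hom {G : Type*} [Group G] (s r : G) (hs : s ^ 2 = 1) (hr : r ^ 3 = 1) :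
    ∃ f : PSL2Z →* G, f S = s ∧ f R = r := by
  have h : ∀ i : Fin 2, ![s, r] i ^ (i.val + 2) = 1 := by
    intro i
    fin_cases i
    · exact hs
    · exact hr
  let e := MulEquiv.ofBijective ofCoprod ⟨ofCoprod_injective, ofCoprod_surjective⟩
  let F : Monoid.CoprodI (fun i : Fin 2 => Multiplicative (ZMod (i.val + 2))) →* G :=
    Monoid.CoprodI.lift fun i => zmodPowHom _ (![s, r] i) (h i)
  have key : ∀ i, F (e.symm (gen i)) = ![s, r] i := by
    intro i
    rw [← ofCoprod_of_ofAdd_one i]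
    rw [show ofCoprod (Monoid.CoprodI.of (i := i) (Multiplicative.ofAdd 1)) =
      e (Monoid.CoprodI.of (i := i) (Multiplicative.ofAdd 1)) from rfl, e.symm_apply_apply]
    simpa [F] using zmodPowHom_ofAdd_natCast _ (![s, r] i) (h i) 1
  exact ⟨F.comp e.symm.toMonoidHom, key 0, key 1⟩

lemma hom_ext {G : Type*} [Group G] {f f' : PSL2Z →* G} (hS : f S = f' S) (hR : f R = f' R) :
    f = f' := by
  refine MonoidHom.eq_of_eqOn_dense closure_S_R ?_
  rintro x (rfl | rfl)
  · exact hS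
  · exact hR

lemma range_eq_closure {G : Type*} [Group G] (f : PSL2Z →* G) :
    f.range = Subgroup.closure {f S, f R} := by
  rw [MonoidHom.range_eq_map, ← closure_S_R, MonoidHom.map_closure, Set.image_pair]

end PSL2Z

section PermutationRepresentation

variable {G X : Type*} [Group G]

/-- The stabilizer of `x` in a permutation representation `f`. -/
def homStabilizer (f : G →* Equiv.Perm X) (x : X) : Subgroup G :=
  (MulAction.stabilizer (Equiv.Perm X) x).comap f

lemma mem_homStabilizer {f : G →* Equiv.Perm X} {x : X} {g : G} :
    g ∈ homStabilizer f x ↔ f g x = x := Iff.rfl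

lemma index_homStabilizer {f : G →* Equiv.Perm X} (x : X) (hf : ∀ i j, ∃ g, f g i = j) :
    (homStabilizer f x).index = Nat.card X := by
  let _ := MulAction.compHom X f
  have : MulAction.IsPretransitive G X := ⟨hf⟩
  exact MulAction.index_stabilizer_of_transitive G x

lemma exists_conj_of_homStabilizer_eq {f f' : G →* Equiv.Perm X} {x : X}
    (hf : ∀ j, ∃ g, f g x = j) (hf' : ∀ j, ∃ g, f' g x = j)
    (h : homStabilizer f x = homStabilizer f' x) :
    ∃ σ : Equiv.Perm X, σ x = x ∧ ∀ g, σ⁻¹ * f' g * σ = f g := by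
  have hrel : ∀ a b, f a x = f b x ↔ f' a x = f' b x := by
    intro a b
    have := SetLike.ext_iff.mp h (a⁻¹ * b)
    simp only [mem_homStabilizer, map_mul, map_inv, Equiv.Perm.mul_apply,
      Equiv.Perm.inv_eq_iff_eq] at this
    rw [eq_comm, this, eq_comm]
  choose c hc using hf
  have hσ : ∀ g, f' (c (f g x)) x = f' g x := fun g => (hrel _ _).mp (hc _)
  let σ : Equiv.Perm X := Equiv.ofBijective (fun j => f' (c j) x) (by
    constructor
    · intro i j hij
      rw [← hc i, ← hc j]
      exact (hrel _ _).mpr hij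
    · intro j
      obtain ⟨g, rfl⟩ := hf' j
      exact ⟨f g x, hσ g⟩)
  have hσ' : ∀ g, σ (f g x) = f' g x := hσ
  refine ⟨σ, by simpa using hσ' 1, fun g => ?_⟩
  rw [mul_assoc, inv_mul_eq_iff_eq_mul]
  ext j
  rw [← hc j]
  rw [Equiv.Perm.mul_apply, hσ', ← Equiv.Perm.mul_apply, ← map_mul, Equiv.Perm.mul_apply,
    ← Equiv.Perm.mul_apply (f g), ← map_mul, hσ']

lemma exists_hom_homStabilizer_eq [Finite X] (H : Subgroup G) (x : X)
    (hH : H.index = Nat.card X) :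
    ∃ f : G →* Equiv.Perm X, (∀ i j, ∃ g, f g i = j) ∧ homStabilizer f x = H := by
  have : Nonempty X := ⟨x⟩
  have : Finite (G ⧸ H) := Nat.finite_of_card_ne_zero
    (by rw [← Subgroup.index_eq_card, hH]; exact Nat.card_pos.ne')
  obtain ⟨e₀⟩ : Nonempty (G ⧸ H ≃ X) := Finite.card_eq.mp hH
  obtain ⟨e, he⟩ : ∃ e : G ⧸ H ≃ X, e (QuotientGroup.mk 1) = x := by
    classical
    exact ⟨e₀.trans (Equiv.swap (e₀ (QuotientGroup.mk 1)) x), by simp⟩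
  refine ⟨(e.permCongrHom.toMonoidHom).comp (MulAction.toPermHom G (G ⧸ H)), ?_, ?_⟩
  · intro i j
    obtain ⟨g, hg⟩ := MulAction.exists_smul_eq G (e.symm i) (e.symm j)
    exact ⟨g, by simp [Equiv.permCongrHom, hg]⟩
  · ext g
    have : e.symm x = QuotientGroup.mk 1 := by rw [← he, e.symm_apply_apply]
    rw [mem_homStabilizer]
    change e (g • e.symm x) = x ↔ _
    rw [← Equiv.eq_symm_apply, this, MulAction.Quotient.smul_mk, eq_comm, QuotientGroup.eq]
    simp

end PermutationRepresentation

namespace LegitimatePair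

variable {μ : ℕ}

/-- The permutation representation of `PSL(2, ℤ)` attached to a legitimate pair. -/
noncomputable def toHom (p : LegitimatePair μ) : PSL2Z →* Equiv.Perm (Fin μ) :=
  (PSL2Z.exists_hom p.1.1 p.1.2 p.2.1 p.2.2.1).choose

lemma toHom_S (p : LegitimatePair μ) : p.toHom PSL2Z.S = p.1.1 :=
  (PSL2Z.exists_hom p.1.1 p.1.2 p.2.1 p.2.2.1).choose_spec.1

lemma toHom_R (p : LegitimatePair μ) : p.toHom PSL2Z.R = p.1.2 :=
  (PSL2Z.exists_hom p.1.1 p.1.2 p.2.1 p.2.2.1).choose_spec.2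

lemma toHom_transitive (p : LegitimatePair μ) (i j : Fin μ) : ∃ g, p.toHom g i = j := by
  obtain ⟨s, hs, hij⟩ := p.2.2.2 i j
  rw [← p.toHom_S, ← p.toHom_R, ← PSL2Z.range_eq_closure] at hs
  obtain ⟨g, rfl⟩ := hs
  exact ⟨g, hij⟩

lemma exists_toHom_eq {f : PSL2Z →* Equiv.Perm (Fin μ)} (hf : ∀ i j, ∃ g, f g i = j) :
    ∃ p : LegitimatePair μ, p.toHom = f := by
  refine ⟨⟨(f PSL2Z.S, f PSL2Z.R), ?_, ?_, fun i j => ?_⟩, ?_⟩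
  · rw [← map_pow, PSL2Z.S_sq, map_one]
  · rw [← map_pow, PSL2Z.R_cube, map_one]
  · obtain ⟨g, hg⟩ := hf i j
    exact ⟨f g, PSL2Z.range_eq_closure f ▸ ⟨g, rfl⟩, hg⟩
  · exact PSL2Z.hom_ext (toHom_S _) (toHom_R _)

lemma homStabilizer_toHom_eq_iff (h : 0 < μ) (p q : LegitimatePair μ) :
    homStabilizer p.toHom ⟨0, h⟩ = homStabilizer q.toHom ⟨0, h⟩ ↔ EquivMod1 p q := by
  constructor
  · intro hpq
    obtain ⟨σ, h0, hσ⟩ := exists_conj_of_homStabilizer_eq (p.toHom_transitive _)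
      (q.toHom_transitive _) hpq
    refine ⟨σ, fun _ => h0, ?_, ?_⟩
    · rw [← p.toHom_S, ← q.toHom_S, hσ]
    · rw [← p.toHom_R, ← q.toHom_R, hσ]
  · rintro ⟨σ, h0, hS, hR⟩
    have hconj : p.toHom = (MulAut.conj σ⁻¹).toMonoidHom.comp q.toHom :=
      PSL2Z.hom_ext (by simp [toHom_S, ← hS]) (by simp [toHom_R, ← hR])
    ext g
    simp [mem_homStabilizer, hconj, Equiv.symm_apply_eq, h0 h]

end LegitimatePair

/-- Millington's theorem: for `μ ≥ 1` there is a one-to-one correspondence between the subgroups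
of `PSL(2, ℤ)` of index `μ` and the equivalence classes modulo 1 of legitimate pairs of
permutations of `Fin μ`. -/
theorem millington_bijection (μ : ℕ) (hμ : 1 ≤ μ) :
    Nonempty ({H : Subgroup PSL2Z // H.index = μ} ≃ Quot (EquivMod1 (μ := μ))) := by
  let F : LegitimatePair μ → {H : Subgroup PSL2Z // H.index = μ} := fun p =>
    ⟨homStabilizer p.toHom ⟨0, hμ⟩, by simp [index_homStabilizer _ p.toHom_transitive]⟩
  have hF : ∀ p q, F p = F q ↔ EquivMod1 p q := fun p q =>
    Subtype.ext_iff.trans (LegitimatePair.homStabilizer_toHom_eq_iff hμ p q)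
  refine ⟨(Equiv.ofBijective (Quot.lift F fun p q hpq => (hF p q).mpr hpq) ⟨?_, ?_⟩).symm⟩
  · rintro ⟨p⟩ ⟨q⟩ hpq
    exact Quot.sound ((hF p q).mp hpq)
  · rintro ⟨H, hH⟩
    obtain ⟨f, hf, rfl⟩ := exists_hom_homStabilizer_eq H (⟨0, hμ⟩ : Fin μ) (by simp [hH])
    obtain ⟨p, rfl⟩ := LegitimatePair.exists_toHom_eq hf
    exact ⟨Quot.mk _ p, rfl⟩
end

section
/- Let K = ℚ[u]/(u³ − 2/823543) (where 823543 = 7⁷), i.e. K is the field obtained by adjoining to ℚ a root u of X³ − 2/7⁷. Then in the polynomial ring K[X] the following identity holds: (X² + 444uX − 148284u²)³ · (X + 516u) = 1728 · (X + 462u)⁴ + (X − 996u) · (X³ + 1422uX² + 822204u²X + 185029704u³)². -/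
open Polynomial

/-- The field `K = ℚ[u]/(u³ - 2/823543)`, i.e. `ℚ((2/7⁷)^{1/3})` (note `823543 = 7⁷`). -/
abbrev BelyiField : Type :=
  AdjoinRoot ((X : ℚ[X]) ^ 3 - C (2 / 823543 : ℚ))

/-- The root `u` of `X³ - 2/7⁷` in `K`. -/
noncomputable def uRoot : BelyiField := AdjoinRoot.root _

/-- The defining relation `7⁷ u³ = 2` of the generator of `K`. -/
theorem uRoot_pow_three : (823543 : BelyiField) * uRoot ^ 3 = 2 := by
  have h : uRoot ^ 3 - algebraMap ℚ BelyiField (2 / 823543) = 0 := by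
    have h := AdjoinRoot.eval₂_root ((X : ℚ[X]) ^ 3 - C (2 / 823543 : ℚ))
    rwa [eval₂_sub, eval₂_X_pow, eval₂_C] at h
  have hc : (823543 : BelyiField) * algebraMap ℚ BelyiField (2 / 823543) = 2 := by
    rw [← map_ofNat (algebraMap ℚ BelyiField) 823543, ← map_mul,
      ← map_ofNat (algebraMap ℚ BelyiField) 2]
    norm_num
  linear_combination 823543 * h + hc

/-- The Belyi map identity `p₃(X) = 1728·p_c(X) + p₂(X)` in `K[X]`:
`(X² + 444uX - 148284u²)³(X + 516u)
  = 1728(X + 462u)⁴ + (X - 996u)(X³ + 1422uX² + 822204u²X + 185029704u³)²`. -/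
theorem belyi_map_polynomial_identity :
    ((X : BelyiField[X]) ^ 2 + C (444 * uRoot) * X - C (148284 * uRoot ^ 2)) ^ 3 *
        (X + C (516 * uRoot)) =
      1728 * (X + C (462 * uRoot)) ^ 4 +
        (X - C (996 * uRoot)) *
          ((X : BelyiField[X]) ^ 3 + C (1422 * uRoot) * X ^ 2 +
            C (822204 * uRoot ^ 2) * X + C (185029704 * uRoot ^ 3)) ^ 2 := by
  have hu : (823543 : BelyiField[X]) * C uRoot ^ 3 = 2 := by
    simpa only [map_mul, map_pow, map_ofNat] using congrArg C uRoot_pow_three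
  simp only [map_mul, map_pow, map_ofNat]
  linear_combination 864 * (X + 462 * C uRoot) ^ 4 * hu
end
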